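/- arXiv:1203.2800 — 10 statements merged into one kernel-verified Lean document; each statement's English description precedes it below -/
import Mathlib

section
/- Let X be a set equipped with a topology τ and a preorder ≤, and let (Y, τ') be a topological space. Then the collection τ_≤ of those members of τ that are ≤-upper sets is a topology on X, and for any function f : X → Y the following are equivalent: (i) f is continuous from (X, τ_≤) to (Y, τ'); (ii) f is continuous from (X, τ) to (Y, τ') and monotone from ≤ to the specialization preorder of (Y, τ'). -/
open Topology

/-- Given a topology `τ` and a preorder `≤` on `X`, the collection
`τ_≤` of `τ`-open `≤`-upper sets is a topology on `X`, and for any topological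
space `(Y, τ')` a function `f : X → Y` is continuous from `(X, τ_≤)` iff it is
continuous from `(X, τ)` and monotone from `≤` to the specialization preorder
of `(Y, τ')`. -/
theorem stmt1 {X Y : Type*} [Preorder X] (τ : TopologicalSpace X) (τ' : TopologicalSpace Y) :
    ∃ t : TopologicalSpace X,
      (∀ U : Set X, IsOpen[t] U ↔ IsOpen[τ] U ∧ IsUpperSet U) ∧
      ∀ f : X → Y,
        Continuous[t, τ'] f ↔
          (Continuous[τ, τ'] f ∧
            ∀ x x' : X, x ≤ x' → ∀ V : Set Y, IsOpen[τ'] V → f x ∈ V → f x' ∈ V) := by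
  refine ⟨{ IsOpen := fun U => IsOpen[τ] U ∧ IsUpperSet U
            isOpen_univ := ⟨isOpen_univ, isUpperSet_univ⟩
            isOpen_inter := fun s t hs ht => ⟨hs.1.inter ht.1, hs.2.inter ht.2⟩
            isOpen_sUnion := fun S hS =>
              ⟨isOpen_sUnion fun s hs => (hS s hs).1,
                isUpperSet_sUnion fun s hs => (hS s hs).2⟩ },
    fun U => Iff.rfl, fun f => ?_⟩
  rw [continuous_def, continuous_def]
  constructor
  · intro h
    exact ⟨fun V hV => (h V hV).1, fun x x' hx V hV hm => (h V hV).2 hx hm⟩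
  · rintro ⟨h1, h2⟩ V hV
    exact ⟨h1 V hV, fun x x' hx hm => h2 x x' hx V hV hm⟩
end

section
/- Let X be a set and A a collection of subsets of X, and let ≤_A denote the specialization preorder of the A-subbasic topology X_A. If the A-patch topology on X is compact, then a subset U of X is open in the A-subbasic topology if and only if U is open in the A-patch topology and U is a ≤_A-upper set. -/
open Topology TopologicalSpace

/-- Let `A` be a collection of subsets of `X`, let `X_A` be the
`A`-subbasic topology and let `≤_A` be its specialization preorder. If the
`A`-patch topology (generated by the members of `A` and their complements) is
compact, then a subset `U` of `X` is open in the `A`-subbasic topology iff `U`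
is open in the `A`-patch topology and `U` is a `≤_A`-upper set. -/
theorem stmt3 {X : Type*} (A : Set (Set X))
    (hcomp : @CompactSpace X (generateFrom (A ∪ compl '' A))) (U : Set X) :
    IsOpen[generateFrom A] U ↔
      (IsOpen[generateFrom (A ∪ compl '' A)] U ∧
        ∀ x y : X, (∀ V : Set X, IsOpen[generateFrom A] V → x ∈ V → y ∈ V) →
          x ∈ U → y ∈ U) := by
  constructor
  · intro hU
    refine ⟨?_, fun x y h hx => h U hU hx⟩
    exact generateFrom_anti (Set.subset_union_left) U hU
  · rintro ⟨hU, hup⟩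
    have key : ∀ x ∈ U, ∃ V, IsOpen[generateFrom A] V ∧ x ∈ V ∧ V ⊆ U := by
      intro x hx
      have hK : @IsCompact X (generateFrom (A ∪ compl '' A)) Uᶜ := by
        letI := generateFrom (A ∪ compl '' A)
        exact (isClosed_compl_iff.mpr hU).isCompact
      obtain ⟨t, ht⟩ := @IsCompact.elim_finite_subcover X
        (generateFrom (A ∪ compl '' A)) _ {a : Set X // a ∈ A ∧ x ∈ a} hK (fun a => (a : Set X)ᶜ)
        (fun a => isOpen_generateFrom_of_mem (Or.inr ⟨a, a.2.1, rfl⟩)) (by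
          intro y hy
          by_contra hn
          have hA : ∀ a ∈ A, x ∈ a → y ∈ a := by
            intro a ha hxa
            by_contra hya
            exact hn (Set.mem_iUnion.mpr ⟨⟨a, ha, hxa⟩, hya⟩)
          apply hy
          refine hup x y ?_ hx
          intro V hV
          induction hV with
          | basic s hs => exact hA s hs
          | univ => exact fun _ => trivial
          | inter s t _ _ ihs iht => exact fun h => ⟨ihs h.1, iht h.2⟩
          | sUnion S _ ih =>
            rintro ⟨s, hs, hxs⟩
            exact ⟨s, hs, ih s hs hxs⟩)
      refine ⟨⋂ a ∈ t, (a : Set X), ?_, ?_, ?_⟩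
      · letI := generateFrom A
        exact isOpen_biInter_finset fun a _ => isOpen_generateFrom_of_mem a.2.1
      · exact Set.mem_iInter₂.mpr fun a _ => a.2.2
      · intro y hy
        by_contra hyU
        obtain ⟨a, ha, hya⟩ := Set.mem_iUnion₂.mp (ht hyU)
        exact hya (Set.mem_iInter₂.mp hy a ha)
    letI := generateFrom A
    refine isOpen_iff_forall_mem_open.mpr fun x hx => ?_
    obtain ⟨V, h1, h2, h3⟩ := key x hx
    exact ⟨V, h3, h1, h2⟩
end

section
/- Let X be a set, A a collection of subsets of X, τ a compact topology on X, and ≤ a partial order on X. Then the following are equivalent: (1) τ is the A-patch topology on X and ≤ is the specialization preorder of the A-subbasic topology X_A; (2) every member of A is a τ-clopen ≤-upper set, and for all x, y ∈ X with x ≰ y there exists U ∈ A with x ∈ U and y ∉ U. -/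
open Topology TopologicalSpace

theorem spec_of_subbasis {X : Type*} (A : Set (Set X)) (x y : X)
    (h : ∀ U ∈ A, x ∈ U → y ∈ U) :
    ∀ U : Set X, IsOpen[generateFrom A] U → x ∈ U → y ∈ U := by
  intro U hU
  change GenerateOpen A U at hU
  induction hU with
  | basic s hs => exact h s hs
  | univ => exact fun _ => trivial
  | inter s t _ _ hs ht => exact fun hx => ⟨hs hx.1, ht hx.2⟩
  | sUnion S _ ih => exact fun ⟨t, ht, hx⟩ => ⟨t, ht, ih t ht hx⟩

theorem eq_of_le_compact_t2 {X : Type*} (τ σ : TopologicalSpace X)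
    (hc : @CompactSpace X τ) (h2 : @T2Space X σ) (h : τ ≤ σ) : τ = σ := by
  refine le_antisymm h ?_
  have hcont : @Continuous X X τ σ id := continuous_id_iff_le.2 h
  have hcl := @Continuous.isClosedMap X X τ σ hc h2 id hcont
  intro U hU
  have h3 := hcl Uᶜ ((@isClosed_compl_iff X τ U).2 hU)
  rw [Set.image_id] at h3
  exact (@isClosed_compl_iff X σ U).1 h3

/-- Let `X` carry a collection `A` of subsets, a compact topology
`τ`, and a partial order `≤`. Then (`τ` is the `A`-patch topology and `≤` is
the specialization preorder of the `A`-subbasic topology) iff (every member of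
`A` is a `τ`-clopen `≤`-upper set and for all `x ≰ y` there is `U ∈ A` with
`x ∈ U` and `y ∉ U`). -/
theorem stmt4 {X : Type*} [PartialOrder X] (A : Set (Set X)) (τ : TopologicalSpace X)
    (hcomp : @CompactSpace X τ) :
    (τ = generateFrom (A ∪ compl '' A) ∧
        ∀ x y : X, x ≤ y ↔ ∀ U : Set X, IsOpen[generateFrom A] U → x ∈ U → y ∈ U) ↔
      ((∀ U ∈ A, @IsClopen X τ U ∧ IsUpperSet U) ∧
        ∀ x y : X, ¬x ≤ y → ∃ U ∈ A, x ∈ U ∧ y ∉ U) := by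
  constructor
  · rintro ⟨rfl, hle⟩
    refine ⟨fun U hU => ⟨⟨?_, ?_⟩, ?_⟩, ?_⟩
    · exact @IsClosed.mk X (generateFrom (A ∪ compl '' A)) U (GenerateOpen.basic _ (Or.inr ⟨U, hU, rfl⟩))
    · exact GenerateOpen.basic _ (Or.inl hU)
    · intro x y hxy hx
      exact (hle x y).1 hxy U (GenerateOpen.basic _ hU) hx
    · intro x y hxy
      by_contra! hcon
      exact hxy ((hle x y).2 (spec_of_subbasis A x y hcon))
  · rintro ⟨hA, hsep⟩
    refine ⟨?_, ?_⟩
    · apply eq_of_le_compact_t2 τ _ hcomp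
      · refine @T2Space.mk X (generateFrom (A ∪ compl '' A)) ?_
        intro x y hne
        by_cases hxy : x ≤ y
        · have hyx : ¬ y ≤ x := fun h => hne (le_antisymm hxy h)
          obtain ⟨U, hU, h1, h2⟩ := hsep y x hyx
          exact ⟨Uᶜ, U, GenerateOpen.basic _ (Or.inr ⟨U, hU, rfl⟩),
            GenerateOpen.basic _ (Or.inl hU), h2, h1, disjoint_compl_left⟩
        · obtain ⟨U, hU, h1, h2⟩ := hsep x y hxy
          exact ⟨U, Uᶜ, GenerateOpen.basic _ (Or.inl hU),
            GenerateOpen.basic _ (Or.inr ⟨U, hU, rfl⟩), h1, h2, disjoint_compl_right⟩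
      · apply le_generateFrom
        rintro _ (hU | ⟨U, hU, rfl⟩)
        · exact (hA _ hU).1.2
        · exact (hA _ hU).1.1.1
    · intro x y
      constructor
      · intro hxy
        exact spec_of_subbasis A x y fun U hU hx => (hA U hU).2 hxy hx
      · intro h
        by_contra hxy
        obtain ⟨U, hU, h1, h2⟩ := hsep x y hxy
        exact h2 (h U (GenerateOpen.basic _ hU) h1)
end

section
/- Let X be a set and A a collection of subsets of X such that the A-patch topology on X is compact, and let ≤_A denote the specialization preorder of the A-subbasic topology X_A. Then: (a) (X, A-patch topology, ≤_A) satisfies the Priestley separation axiom, i.e. for all x, y ∈ X with x ≰_A y there exists a patch-clopen ≤_A-upper set U with x ∈ U and y ∉ U; (b) the patch-clopen ≤_A-upper subsets of X are exactly the subsets expressible as finite unions of finite intersections of members of A; (c) the ≤_A-upper patch-open subsets of X are exactly the open sets of the A-subbasic topology X_A. -/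
open Topology TopologicalSpace

/-- The `A`-patch topology: generated by the members of `A` together with their
complements. -/
def patchTopology {X : Type*} (A : Set (Set X)) : TopologicalSpace X :=
  generateFrom (A ∪ compl '' A)

/-- The specialization preorder of the `A`-subbasic topology: `x ≤_A y` iff every
open set of the topology generated by `A` containing `x` also contains `y`. -/
def specLE {X : Type*} (A : Set (Set X)) (x y : X) : Prop :=
  ∀ V : Set X, IsOpen[generateFrom A] V → x ∈ V → y ∈ V

/-- `U` is an upper set for the specialization preorder `≤_A`. -/
def IsSpecUpper {X : Type*} (A : Set (Set X)) (U : Set X) : Prop :=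
  ∀ x y : X, specLE A x y → x ∈ U → y ∈ U

theorem specLE_of_forall {X : Type*} (A : Set (Set X)) (x y : X)
    (h : ∀ a ∈ A, x ∈ a → y ∈ a) : specLE A x y := by
  intro V hV
  induction hV with
  | basic s hs => exact h s hs
  | univ => intro _; trivial
  | inter s t _ _ hs ht => exact fun hx => ⟨hs hx.1, ht hx.2⟩
  | sUnion S _ ih => 
    rintro ⟨t, ht, hx⟩
    exact ⟨t, ht, ih t ht hx⟩

theorem patch_isClopen {X : Type*} (A : Set (Set X)) (a : Set X) (ha : a ∈ A) :
    @IsClopen X (patchTopology A) a := by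
  letI := patchTopology A
  refine ⟨⟨?_⟩, ?_⟩
  · exact isOpen_generateFrom_of_mem (Or.inr ⟨a, ha, rfl⟩)
  · exact isOpen_generateFrom_of_mem (Or.inl ha)

theorem patch_key {X : Type*} (A : Set (Set X)) (hcomp : @CompactSpace X (patchTopology A))
    (U : Set X) (hU : IsOpen[patchTopology A] U) (hup : IsSpecUpper A U) (x : X) (hx : x ∈ U) :
    ∃ F : Set (Set X), F.Finite ∧ F ⊆ A ∧ x ∈ ⋂₀ F ∧ ⋂₀ F ⊆ U := by
  letI := patchTopology A
  have hc : IsCompact Uᶜ := hU.isClosed_compl.isCompact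
  obtain ⟨T, hT, hTf, hcov⟩ := hc.elim_finite_subcover_image (b := {a | a ∈ A ∧ x ∈ a})
    (c := compl) (fun a ha => (patch_isClopen A a ha.1).compl.isOpen) (by
      intro y hy
      by_contra hn
      refine hy (hup x y (specLE_of_forall A x y fun a ha hxa => ?_) hx)
      by_contra hya
      exact hn (Set.mem_biUnion (x := a) ⟨ha, hxa⟩ hya))
  refine ⟨T, hTf, fun a ha => (hT ha).1, fun a ha => (hT ha).2, fun y hy => ?_⟩
  by_contra hyU
  obtain ⟨a, ha, hya⟩ := Set.mem_iUnion₂.1 (hcov hyU)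
  exact hya (hy a ha)

/-- If the `A`-patch topology on `X` is compact, then
(a) `(X, A-patch, ≤_A)` satisfies the Priestley separation axiom;
(b) the patch-clopen `≤_A`-upper sets are exactly the finite unions of finite
intersections of members of `A`;
(c) the `≤_A`-upper patch-open sets are exactly the opens of the `A`-subbasic
topology. -/
theorem stmt5 {X : Type*} (A : Set (Set X)) (hcomp : @CompactSpace X (patchTopology A)) :
    (∀ x y : X, ¬specLE A x y →
      ∃ U : Set X, @IsClopen X (patchTopology A) U ∧ IsSpecUpper A U ∧ x ∈ U ∧ y ∉ U) ∧
    (∀ U : Set X,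
      (@IsClopen X (patchTopology A) U ∧ IsSpecUpper A U) ↔
        ∃ S : Set (Set X), S.Finite ∧
          (∀ T ∈ S, ∃ F : Set (Set X), F.Finite ∧ F ⊆ A ∧ T = ⋂₀ F) ∧ U = ⋃₀ S) ∧
    (∀ U : Set X,
      (IsSpecUpper A U ∧ IsOpen[patchTopology A] U) ↔ IsOpen[generateFrom A] U) := by
  have hopen : ∀ F : Set (Set X), F.Finite → F ⊆ A → IsOpen[generateFrom A] (⋂₀ F) := by
    intro F hF hFA
    letI := generateFrom A
    exact hF.isOpen_sInter fun a ha => isOpen_generateFrom_of_mem (hFA ha)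
  have hclopen : ∀ F : Set (Set X), F.Finite → F ⊆ A →
      @IsClopen X (patchTopology A) (⋂₀ F) := by
    intro F hF hFA
    letI := patchTopology A
    rw [Set.sInter_eq_biInter]
    exact hF.isClopen_biInter fun a ha => patch_isClopen A a (hFA ha)
  have hupper : ∀ U : Set X, IsOpen[generateFrom A] U → IsSpecUpper A U :=
    fun U hU x y hxy hx => hxy U hU hx
  refine ⟨?_, ?_, ?_⟩
  · intro x y hxy
    by_contra hn
    refine hxy (specLE_of_forall A x y fun a ha hxa => ?_)
    by_contra hya
    exact hn ⟨a, patch_isClopen A a ha, hupper a (isOpen_generateFrom_of_mem ha), hxa, hya⟩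
  · intro U
    constructor
    · rintro ⟨hU, hup⟩
      letI := patchTopology A
      have hc : IsCompact U := hU.isClosed.isCompact
      obtain ⟨S, hS, hSf, hcov⟩ := hc.elim_finite_subcover_image
        (b := {T | (∃ F : Set (Set X), F.Finite ∧ F ⊆ A ∧ T = ⋂₀ F) ∧ T ⊆ U}) (c := id)
        (by
          rintro T ⟨⟨F, hF, hFA, rfl⟩, _⟩
          exact (hclopen F hF hFA).isOpen)
        (by
          intro x hx
          obtain ⟨F, hF, hFA, hxF, hFU⟩ := patch_key A hcomp U hU.isOpen hup x hx
          exact Set.mem_biUnion (x := ⋂₀ F) ⟨⟨F, hF, hFA, rfl⟩, hFU⟩ hxF)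
      refine ⟨S, hSf, fun T hT => (hS hT).1, Set.Subset.antisymm ?_ ?_⟩
      · rw [Set.sUnion_eq_biUnion]; exact hcov
      · exact Set.sUnion_subset fun T hT => (hS hT).2
    · rintro ⟨S, hS, hSF, rfl⟩
      constructor
      · letI := patchTopology A
        rw [Set.sUnion_eq_biUnion]
        refine hS.isClopen_biUnion fun T hT => ?_
        obtain ⟨F, hF, hFA, rfl⟩ := hSF T hT
        exact hclopen F hF hFA
      · apply hupper
        letI := generateFrom A
        refine isOpen_sUnion fun T hT => ?_
        obtain ⟨F, hF, hFA, rfl⟩ := hSF T hT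
        exact hopen F hF hFA
  · intro U
    constructor
    · rintro ⟨hup, hU⟩
      letI := generateFrom A
      refine isOpen_iff_forall_mem_open.2 fun x hx => ?_
      obtain ⟨F, hF, hFA, hxF, hFU⟩ := patch_key A hcomp U hU hup x hx
      exact ⟨_, hFU, hopen F hF hFA, hxF⟩
    · intro hU
      exact ⟨hupper U hU, (generateFrom_anti Set.subset_union_left : patchTopology A ≤ _) U hU⟩
end

section
/- Let M be a meet-semilattice with a greatest element. Let X_M be the set of all filters of M, for m ∈ M let U_m = {F ∈ X_M : m ∈ F}, let τ be the topology on X_M generated by the sets U_m (m ∈ M) together with their complements as a subbasis, and order X_M by inclusion. Then (X_M, τ, ⊆) is a Priestley space: τ is compact, and for all F, F' ∈ X_M with F ⊄ F' there is m ∈ F ∖ F' such that U_m is a τ-clopen ⊆-upper set with F ∈ U_m and F' ∉ U_m. -/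
open TopologicalSpace

/-- A filter of a meet-semilattice with greatest element: contains `⊤`, is
upward closed and is closed under binary meets. -/
def MsFilter {M : Type*} [SemilatticeInf M] [OrderTop M] (F : Set M) : Prop :=
  (⊤ : M) ∈ F ∧ (∀ a ∈ F, ∀ b : M, a ≤ b → b ∈ F) ∧ ∀ a ∈ F, ∀ b ∈ F, a ⊓ b ∈ F

/-- The set `X_M` of all filters of `M`. -/
def msFilterSpace (M : Type*) [SemilatticeInf M] [OrderTop M] :=
  {F : Set M // MsFilter F}

/-- The basic set `U_m = {F ∈ X_M : m ∈ F}`. -/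
def Um {M : Type*} [SemilatticeInf M] [OrderTop M] (m : M) : Set (msFilterSpace M) :=
  {F : msFilterSpace M | m ∈ F.1}

/-- The patch-type topology on `X_M`, generated by the sets `U_m` together with
their complements as a subbasis. -/
def filtTop (M : Type*) [SemilatticeInf M] [OrderTop M] :
    TopologicalSpace (msFilterSpace M) :=
  generateFrom (Set.range (Um (M := M)) ∪ compl '' Set.range (Um (M := M)))

/-- `(X_M, τ, ⊆)` is a Priestley space: `τ` is compact, and for
all filters `F ⊄ F'` there is `m ∈ F ∖ F'` such that `U_m` is a `τ`-clopen
`⊆`-upper set with `F ∈ U_m` and `F' ∉ U_m`. -/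
theorem stmt10 {M : Type*} [SemilatticeInf M] [OrderTop M] :
    @CompactSpace (msFilterSpace M) (filtTop M) ∧
      ∀ F F' : msFilterSpace M, ¬F.1 ⊆ F'.1 →
        ∃ m : M, m ∈ F.1 ∧ m ∉ F'.1 ∧ @IsClopen _ (filtTop M) (Um m) ∧
          (∀ G G' : msFilterSpace M, G.1 ⊆ G'.1 → G ∈ Um m → G' ∈ Um m) ∧
          F ∈ Um m ∧ F' ∉ Um m := by
  have hUo : ∀ m : M, @IsOpen _ (filtTop M) (Um m) := fun m =>
    isOpen_generateFrom_of_mem (Or.inl ⟨m, rfl⟩)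
  have hUc : ∀ m : M, @IsOpen _ (filtTop M) (Um m)ᶜ := fun m =>
    isOpen_generateFrom_of_mem (Or.inr ⟨_, ⟨m, rfl⟩, rfl⟩)
  refine ⟨?_, ?_⟩
  · letI := filtTop M
    refine ⟨isCompact_iff_ultrafilter_le_nhds.2 fun f _ => ?_⟩
    have hF : MsFilter {m : M | Um m ∈ f} := by
      refine ⟨?_, ?_, ?_⟩
      · exact Filter.mem_of_superset Filter.univ_mem fun G _ => G.2.1
      · intro a ha b hab
        exact Filter.mem_of_superset ha fun G hG => G.2.2.1 a hG b hab
      · intro a ha b hb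
        exact Filter.mem_of_superset (Filter.inter_mem ha hb)
          fun G hG => G.2.2.2 a hG.1 b hG.2
    refine ⟨⟨_, hF⟩, Set.mem_univ _, ?_⟩
    have hn := nhds_generateFrom
      (g := Set.range (Um (M := M)) ∪ compl '' Set.range (Um (M := M)))
      (a := (⟨_, hF⟩ : msFilterSpace M))
    refine le_trans ?_ hn.ge
    refine le_iInf₂ fun s hs => Filter.le_principal_iff.2 ?_
    obtain ⟨hs, ⟨m, rfl⟩ | ⟨_, ⟨m, rfl⟩, rfl⟩⟩ := hs
    · exact hs
    · exact Ultrafilter.compl_mem_iff_notMem.2 hs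
  · intro F F' h
    obtain ⟨m, hm, hm'⟩ := Set.not_subset.1 h
    exact ⟨m, hm, hm', ⟨@IsClosed.mk _ (filtTop M) _ (hUc m), hUo m⟩,
      fun G G' hG h => hG h, hm, hm'⟩
end

section
/- Let M be a meet-semilattice with a greatest element, let X_M be the set of all filters of M with the topology τ generated by the sets U_m = {F ∈ X_M : m ∈ F} (m ∈ M) and their complements, ordered by inclusion. Call a τ-clopen ⊆-upper subset U of X_M weakly indecomposable if whenever U is the union of a finite family of τ-clopen ⊆-upper sets, U equals one of the members of that family. Then the weakly indecomposable clopen upper subsets of X_M are exactly the sets U_m for m ∈ M, and the map m ↦ U_m is an order isomorphism from M onto the set of weakly indecomposable clopen upper subsets of X_M ordered by inclusion. -/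
open TopologicalSpace

/-- `U` is an upper set for the inclusion order on filters. -/
def IsUpperFilt {M : Type*} [SemilatticeInf M] [OrderTop M]
    (U : Set (msFilterSpace M)) : Prop :=
  ∀ G G' : msFilterSpace M, G.1 ⊆ G'.1 → G ∈ U → G' ∈ U

/-- A weakly indecomposable clopen upper set: a `τ`-clopen `⊆`-upper set which,
whenever it is the union of a finite family of `τ`-clopen `⊆`-upper sets,
equals one of the members of the family. -/
def WIndec {M : Type*} [SemilatticeInf M] [OrderTop M]
    (U : Set (msFilterSpace M)) : Prop :=
  @IsClopen _ (filtTop M) U ∧ IsUpperFilt U ∧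
    ∀ S : Set (Set (msFilterSpace M)), S.Finite →
      (∀ V ∈ S, @IsClopen _ (filtTop M) V ∧ IsUpperFilt V) →
      U = ⋃₀ S → ∃ V ∈ S, U = V

theorem Um_clopen {M : Type*} [SemilatticeInf M] [OrderTop M] (m : M) :
    @IsClopen _ (filtTop M) (Um m) := by
  letI := filtTop M
  refine ⟨⟨isOpen_generateFrom_of_mem (Or.inr ⟨Um m, ⟨m, rfl⟩, rfl⟩)⟩,
    isOpen_generateFrom_of_mem (Or.inl ⟨m, rfl⟩)⟩

theorem Um_upper {M : Type*} [SemilatticeInf M] [OrderTop M] (m : M) :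
    IsUpperFilt (Um m) := fun _ _ h hG => h hG

def prinFilt {M : Type*} [SemilatticeInf M] [OrderTop M] (m : M) : msFilterSpace M :=
  ⟨{a | m ≤ a}, le_top, fun _ ha _ hb => le_trans ha hb, fun _ ha _ hb => le_inf ha hb⟩

theorem filt_compact (M : Type*) [SemilatticeInf M] [OrderTop M] :
    @CompactSpace _ (filtTop M) := by
  letI := filtTop M
  refine ⟨isCompact_iff_ultrafilter_le_nhds.2 fun f _ => ?_⟩
  refine ⟨⟨{m | Um m ∈ f}, ?_, ?_, ?_⟩, trivial, ?_⟩
  · exact Filter.mem_of_superset Filter.univ_mem fun F _ => F.2.1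
  · intro a ha b hab
    exact Filter.mem_of_superset ha fun F hF => F.2.2.1 a hF b hab
  · intro a ha b hb
    exact Filter.mem_of_superset (Filter.inter_mem ha hb) fun F hF => F.2.2.2 a hF.1 b hF.2
  · refine le_of_le_of_eq ?_ (nhds_generateFrom
      (g := Set.range (Um (M := M)) ∪ compl '' Set.range (Um (M := M)))).symm
    refine le_iInf₂ fun s hs => ?_
    rw [Filter.le_principal_iff]
    obtain ⟨h1, ⟨m, rfl⟩ | ⟨_, ⟨m, rfl⟩, rfl⟩⟩ := hs
    · exact h1
    · exact Ultrafilter.compl_mem_iff_notMem.2 h1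

theorem exists_Um {M : Type*} [SemilatticeInf M] [OrderTop M] (U : Set (msFilterSpace M))
    (hU : @IsClopen _ (filtTop M) U) (hup : IsUpperFilt U) (F : msFilterSpace M) (hF : F ∈ U) :
    ∃ m, F ∈ Um m ∧ Um m ⊆ U := by
  letI := filtTop M
  haveI := filt_compact M
  haveI : Nonempty F.1 := ⟨⟨⊤, F.2.1⟩⟩
  obtain ⟨m, hm⟩ := (hU.compl.isClosed.isCompact).elim_directed_cover
    (fun m : F.1 => (Um m.1)ᶜ) (fun m => (Um_clopen m.1).compl.isOpen) (by
      intro G hG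
      by_contra h
      simp only [Set.mem_iUnion, not_exists, Set.mem_compl_iff, not_not] at h
      exact hG (hup F G (fun a ha => h ⟨a, ha⟩) hF)) (by
      intro a b
      refine ⟨⟨a.1 ⊓ b.1, F.2.2.2 _ a.2 _ b.2⟩, ?_, ?_⟩
      · exact Set.compl_subset_compl.2 fun G hG => G.2.2.1 _ hG _ inf_le_left
      · exact Set.compl_subset_compl.2 fun G hG => G.2.2.1 _ hG _ inf_le_right)
  exact ⟨m.1, m.2, Set.compl_subset_compl.1 hm⟩

/-- The weakly indecomposable clopen upper subsets of `X_M` are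
exactly the sets `U_m` for `m ∈ M`, and `m ↦ U_m` is an order isomorphism from
`M` onto the set of such subsets ordered by inclusion. -/
theorem stmt11 {M : Type*} [SemilatticeInf M] [OrderTop M] :
    (∀ U : Set (msFilterSpace M), WIndec U ↔ ∃ m : M, U = Um m) ∧
      ∀ m m' : M, m ≤ m' ↔ Um m ⊆ Um m' := by
  refine ⟨fun U => ⟨?_, ?_⟩, fun m m' => ⟨fun h F hF => F.2.2.1 _ hF _ h, fun h => ?_⟩⟩
  · rintro ⟨hc, hu, hS⟩
    letI := filtTop M
    haveI := filt_compact M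
    obtain ⟨t, ht⟩ := hc.isClosed.isCompact.elim_finite_subcover
      (fun m : {m : M // Um m ⊆ U} => Um m.1) (fun m => (Um_clopen m.1).isOpen) (by
        intro F hF
        obtain ⟨m, h1, h2⟩ := exists_Um U hc hu F hF
        exact Set.mem_iUnion.2 ⟨⟨m, h2⟩, h1⟩)
    obtain ⟨V, ⟨m, _, rfl⟩, hV⟩ := hS ((fun m : {m : M // Um m ⊆ U} => Um m.1) '' (t : Set _))
      (t.finite_toSet.image _) (by
        rintro _ ⟨m, _, rfl⟩
        exact ⟨Um_clopen _, Um_upper _⟩) (by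
        apply Set.Subset.antisymm
        · intro F hF
          obtain ⟨m, hm, h⟩ := Set.mem_iUnion₂.1 (ht hF)
          exact ⟨_, ⟨m, hm, rfl⟩, h⟩
        · rintro F ⟨_, ⟨m, _, rfl⟩, h⟩
          exact m.2 h)
    exact ⟨m.1, hV⟩
  · rintro ⟨m, rfl⟩
    refine ⟨Um_clopen m, Um_upper m, fun S _ hS hU => ?_⟩
    have h : prinFilt m ∈ Um m := le_refl m
    rw [hU] at h
    obtain ⟨V, hV, h⟩ := h
    refine ⟨V, hV, Set.Subset.antisymm ?_ ?_⟩
    · intro G hG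
      exact (hS V hV).2 (prinFilt m) G (fun a ha => G.2.2.1 _ hG _ ha) h
    · rw [hU]
      exact Set.subset_sUnion_of_mem hV
  · exact h (show prinFilt m ∈ Um m from le_refl m)
end

section
/- Let P be a poset such that: (a) there is a finite subset {c₁, …, cₙ} of P with the property that every c ∈ P satisfies c ≤ cᵢ for some i; and (b) for all a, b ∈ P there is a finite subset {d₁, …, d_m} of P with each d_j ≤ a and d_j ≤ b, such that every d ∈ P with d ≤ a and d ≤ b satisfies d ≤ d_j for some j. Let X_P be the set of order filters of P, for a ∈ P let U_a = {F ∈ X_P : a ∈ F}, let τ be the topology on X_P generated by the sets U_a (a ∈ P) together with their complements as a subbasis, and order X_P by inclusion. Then (X_P, τ, ⊆) is a Priestley space, and for every a ∈ P the set U_a is a weakly indecomposable τ-clopen ⊆-upper set; in particular, for F, F' ∈ X_P with F ⊄ F' there is a weakly indecomposable clopen ⊆-upper set containing F and not F'. -/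
open TopologicalSpace

/-- An order filter of a poset: a nonempty, upward closed, downward directed
subset. -/
def IsOrderFilter {P : Type*} [PartialOrder P] (F : Set P) : Prop :=
  F.Nonempty ∧ (∀ a ∈ F, ∀ b : P, a ≤ b → b ∈ F) ∧
    ∀ a ∈ F, ∀ b ∈ F, ∃ c ∈ F, c ≤ a ∧ c ≤ b

/-- The set `X_P` of all order filters of `P`. -/
def ordFilterSpace (P : Type*) [PartialOrder P] := {F : Set P // IsOrderFilter F}

/-- The basic set `U_a = {F ∈ X_P : a ∈ F}`. -/
def Ua {P : Type*} [PartialOrder P] (a : P) : Set (ordFilterSpace P) :=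
  {F : ordFilterSpace P | a ∈ F.1}

/-- The patch-type topology on `X_P` generated by the sets `U_a` together with
their complements. -/
def cohTop (P : Type*) [PartialOrder P] : TopologicalSpace (ordFilterSpace P) :=
  generateFrom (Set.range (Ua (P := P)) ∪ compl '' Set.range (Ua (P := P)))

/-- `U` is an upper set for the inclusion order on order filters. -/
def IsUpperOF {P : Type*} [PartialOrder P] (U : Set (ordFilterSpace P)) : Prop :=
  ∀ G G' : ordFilterSpace P, G.1 ⊆ G'.1 → G ∈ U → G' ∈ U

/-- A weakly indecomposable clopen upper set: a clopen `⊆`-upper set which,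
whenever it is the union of a finite family of clopen `⊆`-upper sets, equals
one of the members of the family. -/
def WIndecOF {P : Type*} [PartialOrder P] (U : Set (ordFilterSpace P)) : Prop :=
  @IsClopen _ (cohTop P) U ∧ IsUpperOF U ∧
    ∀ S : Set (Set (ordFilterSpace P)), S.Finite →
      (∀ V ∈ S, @IsClopen _ (cohTop P) V ∧ IsUpperOF V) →
      U = ⋃₀ S → ∃ V ∈ S, U = V

theorem isClopen_Ua {P : Type*} [PartialOrder P] (a : P) : @IsClopen _ (cohTop P) (Ua a) := by
  letI := cohTop P
  refine ⟨⟨?_⟩, ?_⟩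
  · exact isOpen_generateFrom_of_mem (Or.inr ⟨_, ⟨a, rfl⟩, rfl⟩)
  · exact isOpen_generateFrom_of_mem (Or.inl ⟨a, rfl⟩)

theorem windec_Ua {P : Type*} [PartialOrder P] (a : P) : WIndecOF (Ua a) := by
  refine ⟨isClopen_Ua a, fun G G' h hG => h hG, ?_⟩
  intro S _ hS hU
  let p : ordFilterSpace P := ⟨Set.Ici a, ⟨a, le_refl a⟩,
    fun x hx b hb => le_trans (Set.mem_Ici.1 hx) hb,
    fun x hx y hy => ⟨a, le_refl a, hx, hy⟩⟩
  have hp : p ∈ Ua a := le_refl a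
  have hp' := hp
  rw [hU] at hp'
  obtain ⟨V, hV, hpV⟩ := hp'
  refine ⟨V, hV, Set.Subset.antisymm ?_ ?_⟩
  · intro G hG
    exact (hS V hV).2 p G (fun x hx => G.2.2.1 a hG x hx) hpV
  · rw [hU]
    exact Set.subset_sUnion_of_mem hV

theorem compact_coh {P : Type*} [PartialOrder P]
    (hfin : ∃ s : Finset P, ∀ c : P, ∃ i ∈ s, c ≤ i)
    (hmeet : ∀ a b : P, ∃ s : Finset P, (∀ d ∈ s, d ≤ a ∧ d ≤ b) ∧
      ∀ d : P, d ≤ a → d ≤ b → ∃ j ∈ s, d ≤ j) :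
    @CompactSpace (ordFilterSpace P) (cohTop P) := by
  letI := cohTop P
  refine ⟨isCompact_iff_ultrafilter_le_nhds.2 ?_⟩
  intro u _
  have key : ∀ (s : Finset P) (A : Set (ordFilterSpace P)), A ∈ u →
      (∀ F ∈ A, ∃ i ∈ s, i ∈ F.1) → ∃ i ∈ s, Ua i ∈ u := by
    intro s A hA h
    refine (Ultrafilter.finite_biUnion_mem_iff (s := fun i => Ua i) s.finite_toSet).1 ?_
    refine Filter.mem_of_superset hA ?_
    intro F hF
    obtain ⟨i, hi, hiF⟩ := h F hF
    exact Set.mem_biUnion (show i ∈ (s : Set P) from hi) hiF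
  let F : ordFilterSpace P := ⟨{a | Ua a ∈ u}, by
    refine ⟨?_, ?_, ?_⟩
    · obtain ⟨s, hs⟩ := hfin
      obtain ⟨i, _, hi⟩ := key s Set.univ Filter.univ_mem (by
        intro F _
        obtain ⟨c, hc⟩ := F.2.1
        obtain ⟨i, hi, hci⟩ := hs c
        exact ⟨i, hi, F.2.2.1 c hc i hci⟩)
      exact ⟨i, hi⟩
    · intro a ha b hab
      exact Filter.mem_of_superset ha (fun F hF => F.2.2.1 a hF b hab)
    · intro a ha b hb
      obtain ⟨s, hs, hs'⟩ := hmeet a b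
      obtain ⟨i, his, hi⟩ := key s (Ua a ∩ Ua b) (Filter.inter_mem ha hb) (by
        intro F hF
        obtain ⟨c, hc, hca, hcb⟩ := F.2.2.2 a hF.1 b hF.2
        obtain ⟨i, hi, hci⟩ := hs' c hca hcb
        exact ⟨i, hi, F.2.2.1 c hc i hci⟩)
      exact ⟨i, hi, hs i his⟩⟩
  refine ⟨F, Set.mem_univ _, ?_⟩
  have : @nhds _ (cohTop P) F = _ := nhds_generateFrom
  rw [this]
  refine le_iInf₂ ?_
  rintro t ⟨hF, ht⟩
  rw [Filter.le_principal_iff]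
  rcases ht with ⟨a, rfl⟩ | ⟨_, ⟨a, rfl⟩, rfl⟩
  · exact hF
  · exact Ultrafilter.compl_mem_iff_notMem.2 hF

/-- For a coherent poset `P` (conditions (a) and (b)), the space
of order filters with the patch-type topology and the inclusion order is a
Priestley space, each `U_a` is a weakly indecomposable clopen upper set, and
any two filters `F ⊄ F'` are separated by a weakly indecomposable clopen upper
set. -/
theorem stmt13 {P : Type*} [PartialOrder P]
    (hfin : ∃ s : Finset P, ∀ c : P, ∃ i ∈ s, c ≤ i)
    (hmeet : ∀ a b : P, ∃ s : Finset P, (∀ d ∈ s, d ≤ a ∧ d ≤ b) ∧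
      ∀ d : P, d ≤ a → d ≤ b → ∃ j ∈ s, d ≤ j) :
    @CompactSpace (ordFilterSpace P) (cohTop P) ∧
      (∀ F F' : ordFilterSpace P, ¬F.1 ⊆ F'.1 →
        ∃ U : Set (ordFilterSpace P),
          @IsClopen _ (cohTop P) U ∧ IsUpperOF U ∧ F ∈ U ∧ F' ∉ U) ∧
      (∀ a : P, WIndecOF (Ua a)) ∧
      ∀ F F' : ordFilterSpace P, ¬F.1 ⊆ F'.1 →
        ∃ U : Set (ordFilterSpace P), WIndecOF U ∧ F ∈ U ∧ F' ∉ U := by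
  have sep : ∀ F F' : ordFilterSpace P, ¬F.1 ⊆ F'.1 →
      ∃ U : Set (ordFilterSpace P), WIndecOF U ∧ F ∈ U ∧ F' ∉ U := by
    intro F F' h
    obtain ⟨a, ha, ha'⟩ := Set.not_subset.1 h
    exact ⟨Ua a, windec_Ua a, ha, ha'⟩
  refine ⟨compact_coh hfin hmeet, ?_, windec_Ua, sep⟩
  intro F F' h
  obtain ⟨U, hU, h1, h2⟩ := sep F F' h
  exact ⟨U, hU.1, hU.2.1, h1, h2⟩
end

section
/- Let M be a meet-semilattice with a greatest element, D a bounded distributive lattice, and i : M → D an injection preserving binary meets and sending the top of M to the top of D. Say that i realizes D as the free distributive lattice on M if for every bounded distributive lattice L and every map f : M → L preserving binary meets and top there exists a unique bounded lattice homomorphism g : D → L with g ∘ i = f. Call an element d of D indecomposable if whenever d is the join of a finite subset S of D, then d = s for some s ∈ S. Then i realizes D as the free distributive lattice on M if and only if the image of i is exactly the set of indecomposable elements of D and every element of D is the join of a finite set of indecomposable elements. -/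
/-- An element `d` of a lattice with bottom is indecomposable if whenever `d`
is the join of a finite subset `S`, then `d` equals some member of `S` (finite
joins include the empty join `⊥`). -/
def IsIndecElt {D : Type*} [Lattice D] [OrderBot D] (d : D) : Prop :=
  ∀ S : Finset D, d = S.sup id → ∃ s ∈ S, d = s

theorem fin_join_inf {M D : Type} [DecidableEq M] [SemilatticeInf M]
    [DistribLattice D] [BoundedOrder D] (i : M → D)
    (hinf : ∀ a b : M, i (a ⊓ b) = i a ⊓ i b) (T U : Finset M) :
    T.sup i ⊓ U.sup i = ((T ×ˢ U).image (fun p => p.1 ⊓ p.2)).sup i := by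
  rw [Finset.sup_inf_sup, Finset.sup_image]
  exact Finset.sup_congr rfl (fun p _ => (hinf _ _).symm)

theorem fin_join_gen {M D : Type} [SemilatticeInf M] [OrderTop M]
    [DistribLattice D] [BoundedOrder D]
    (i : M → D)
    (hinf : ∀ a b : M, i (a ⊓ b) = i a ⊓ i b) (htop : i ⊤ = ⊤)
    (H : ∀ (L : Type) [DistribLattice L] [BoundedOrder L] (f : M → L),
        (∀ a b : M, f (a ⊓ b) = f a ⊓ f b) → f ⊤ = ⊤ →
        ∃! g : D → L,
          ((∀ x y : D, g (x ⊓ y) = g x ⊓ g y) ∧ (∀ x y : D, g (x ⊔ y) = g x ⊔ g y) ∧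
            g ⊤ = ⊤ ∧ g ⊥ = ⊥) ∧
            ∀ m : M, g (i m) = f m) (d : D) : ∃ T : Finset M, d = T.sup i := by
  classical
  let E : Sublattice D :=
    { carrier := {d | ∃ T : Finset M, d = T.sup i}
      supClosed' := by
        rintro _ ⟨T, rfl⟩ _ ⟨U, rfl⟩
        exact ⟨T ∪ U, Finset.sup_union.symm⟩
      infClosed' := by
        rintro _ ⟨T, rfl⟩ _ ⟨U, rfl⟩
        exact ⟨_, fin_join_inf i hinf T U⟩ }
  have hi : ∀ m, i m ∈ E := fun m => ⟨{m}, by simp⟩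
  have hb : (⊥ : D) ∈ E := ⟨∅, by simp⟩
  have ht : (⊤ : D) ∈ E := htop ▸ hi ⊤
  letI : BoundedOrder E :=
    { top := ⟨⊤, ht⟩, bot := ⟨⊥, hb⟩
      le_top := fun a => (le_top : (a : D) ≤ ⊤)
      bot_le := fun a => (bot_le : ⊥ ≤ (a : D)) }
  obtain ⟨g, ⟨⟨h1, h2, h3, h4⟩, h5⟩, -⟩ := H E (fun m => ⟨i m, hi m⟩)
    (fun a b => Subtype.ext (hinf a b)) (Subtype.ext htop)
  have key : (fun d => (g d : D)) = id := by
    refine (H D i hinf htop).unique ⟨⟨?_, ?_, ?_, ?_⟩, ?_⟩ ⟨⟨?_, ?_, ?_, ?_⟩, ?_⟩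
    · intro x y; simp [h1]
    · intro x y; simp [h2]
    · simp only [h3]; rfl
    · simp only [h4]; rfl
    · intro m; simp [h5]
    all_goals simp
  have := congrFun key d
  simp only [id] at this
  rw [← this]
  exact (g d).2

/-- For an injection `i : M → D` of a meet-semilattice with top
into a bounded distributive lattice, preserving binary meets and top, `i`
realizes `D` as the free distributive lattice on `M` iff the image of `i` is
exactly the set of indecomposable elements of `D` and every element of `D` is
the join of a finite set of indecomposable elements. -/
theorem stmt14 {M D : Type} [SemilatticeInf M] [OrderTop M]
    [DistribLattice D] [BoundedOrder D]
    (i : M → D) (hinj : Function.Injective i)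
    (hinf : ∀ a b : M, i (a ⊓ b) = i a ⊓ i b) (htop : i ⊤ = ⊤) :
    (∀ (L : Type) [DistribLattice L] [BoundedOrder L] (f : M → L),
        (∀ a b : M, f (a ⊓ b) = f a ⊓ f b) → f ⊤ = ⊤ →
        ∃! g : D → L,
          ((∀ x y : D, g (x ⊓ y) = g x ⊓ g y) ∧ (∀ x y : D, g (x ⊔ y) = g x ⊔ g y) ∧
            g ⊤ = ⊤ ∧ g ⊥ = ⊥) ∧
            ∀ m : M, g (i m) = f m) ↔
      (Set.range i = {d : D | IsIndecElt d} ∧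
        ∀ d : D, ∃ S : Finset D, (∀ s ∈ S, IsIndecElt s) ∧ d = S.sup id) := by
  classical
  have mono : ∀ a b : M, a ≤ b → i a ≤ i b := by
    intro a b h
    rw [← inf_eq_left.2 h, hinf]; exact inf_le_right
  constructor
  · intro H
    have gen := fin_join_gen i hinf htop H
    obtain ⟨g, ⟨⟨h1, h2, h3, h4⟩, h5⟩, -⟩ := H (LowerSet M) LowerSet.Iic
      (fun a b => LowerSet.Iic_inf a b) LowerSet.Iic_top
    have gs : ∀ (S : Finset D), g (S.sup id) = S.sup g := fun S => by
      simpa using Finset.comp_sup_eq_sup_comp (s := S) (f := id) g h2 h4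
    have gT : ∀ (T : Finset M), g (T.sup i) = T.sup LowerSet.Iic := fun T => by
      rw [Finset.comp_sup_eq_sup_comp g h2 h4]
      exact Finset.sup_congr rfl (fun m _ => h5 m)
    have memsup : ∀ {α : Type} (S : Finset α) (F : α → LowerSet M) (m : M),
        m ∈ S.sup F → ∃ s ∈ S, m ∈ F s := by
      intro α S F m
      induction S using Finset.induction_on with
      | empty => intro h; simp at h
      | insert a S ha ih =>
        intro h
        rw [Finset.sup_insert, LowerSet.mem_sup_iff] at h
        rcases h with h | h
        · exact ⟨a, by simp, h⟩
        · obtain ⟨s, hs, h⟩ := ih h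
          exact ⟨s, by simp [hs], h⟩
    have ind : ∀ m, IsIndecElt (i m) := by
      intro m S hS
      have hm : m ∈ S.sup g := by
        rw [← gs, ← hS, h5]; exact LowerSet.mem_Iic_iff.2 le_rfl
      obtain ⟨s, hs, hm⟩ := memsup S g m hm
      refine ⟨s, hs, le_antisymm ?_ ?_⟩
      · obtain ⟨T, rfl⟩ := gen s
        rw [gT] at hm
        obtain ⟨t, ht, hm⟩ := memsup T _ m hm
        exact (mono _ _ (LowerSet.mem_Iic_iff.1 hm)).trans (Finset.le_sup (f := i) ht)
      · rw [hS]; exact Finset.le_sup (f := id) hs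
    refine ⟨Set.Subset.antisymm ?_ ?_, ?_⟩
    · rintro _ ⟨m, rfl⟩; exact ind m
    · intro d hd
      obtain ⟨T, hT⟩ := gen d
      obtain ⟨s, hs, h⟩ := hd (T.image i) (by rw [Finset.sup_image]; exact hT)
      obtain ⟨m, -, rfl⟩ := Finset.mem_image.1 hs
      exact ⟨m, h.symm⟩
    · intro d
      obtain ⟨T, hT⟩ := gen d
      refine ⟨T.image i, ?_, by rw [Finset.sup_image]; exact hT⟩
      intro s hs
      obtain ⟨m, -, rfl⟩ := Finset.mem_image.1 hs
      exact ind m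
  · rintro ⟨hr, hg⟩ L _ _ f finf ftop
    have fmono : ∀ a b : M, a ≤ b → f a ≤ f b := by
      intro a b h
      rw [← inf_eq_left.2 h, finf]; exact inf_le_right
    have ind : ∀ m, IsIndecElt (i m) := fun m => by
      have : i m ∈ Set.range i := ⟨m, rfl⟩
      rw [hr] at this; exact this
    have gen : ∀ d, ∃ T : Finset M, d = T.sup i := by
      intro d
      obtain ⟨S, hS, rfl⟩ := hg d
      have hsub : (S : Set D) ⊆ i '' Set.univ := by
        intro s hs
        rw [Set.image_univ, hr]; exact hS s hs
      obtain ⟨T, -, rfl⟩ := Finset.subset_set_image_iff.1 hsub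
      exact ⟨T, by rw [Finset.sup_image]; rfl⟩
    have key : ∀ (m : M) (T : Finset M), i m ≤ T.sup i → ∃ t ∈ T, m ≤ t := by
      intro m T h
      obtain ⟨s, hs, h⟩ := ind m (T.image (fun t => i (m ⊓ t))) (by
        rw [Finset.sup_image]
        conv_lhs => rw [← inf_eq_left.2 h, Finset.sup_inf_distrib_left]
        exact Finset.sup_congr rfl (fun t _ => (hinf m t).symm))
      obtain ⟨t, ht, rfl⟩ := Finset.mem_image.1 hs
      exact ⟨t, ht, inf_eq_left.1 (hinj h).symm⟩
    have le : ∀ T U : Finset M, T.sup i ≤ U.sup i → T.sup f ≤ U.sup f := by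
      intro T U h
      refine Finset.sup_le fun t ht => ?_
      obtain ⟨u, hu, htu⟩ := key t U ((Finset.le_sup (f := i) ht).trans h)
      exact (fmono _ _ htu).trans (Finset.le_sup (f := f) hu)
    choose T hT using gen
    have gT : ∀ U : Finset M, (T (U.sup i)).sup f = U.sup f := fun U =>
      le_antisymm (le _ _ (hT _).ge) (le _ _ (hT _).le)
    have gi : ∀ m, (T (i m)).sup f = f m := fun m => by
      simpa using gT {m}
    refine ⟨fun d => (T d).sup f, ⟨⟨?_, ?_, ?_, ?_⟩, gi⟩, ?_⟩
    · intro x y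
      have : x ⊓ y = _ := (congrArg₂ (· ⊓ ·) (hT x) (hT y)).trans
        (fin_join_inf i hinf (T x) (T y))
      simp only
      rw [this, gT, ← fin_join_inf f finf]
    · intro x y
      have : x ⊔ y = (T x ∪ T y).sup i := by
        rw [Finset.sup_union, ← hT, ← hT]
      simp only
      rw [this, gT, Finset.sup_union]
    · simp only
      rw [← htop, gi, ftop]
    · simpa using gT ∅
    · rintro g ⟨⟨h1, h2, h3, h4⟩, h5⟩
      funext d
      conv_lhs => rw [hT d]
      rw [Finset.comp_sup_eq_sup_comp g h2 h4]
      exact Finset.sup_congr rfl (fun m _ => h5 m)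
end

section
/- Let P be a poset and let A_P denote the frame of lower sets of P ordered by inclusion, with η : P → A_P the map sending p to the principal lower set ↓p = {q ∈ P : q ≤ p}. Then (A_P, η) is the free frame on P relative to the class of flat-type maps: for every frame F and every monotone map f : P → F such that the supremum of {f(p) : p ∈ P} equals the top of F, and such that for all a, b ∈ P the meet f(a) ∧ f(b) equals the supremum of {f(c) : c ∈ P, c ≤ a and c ≤ b}, there exists a unique frame homomorphism g : A_P → F with g ∘ η = f. -/
/-- The frame of lower sets of a poset `P`, together with the map
`p ↦ ↓p`, is the free frame on `P` relative to the class of flat-type maps: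
every monotone map `f : P → F` to a frame with `⨆ f = ⊤` and
`f a ⊓ f b = sSup {f c : c ≤ a, c ≤ b}` extends uniquely to a frame
homomorphism `g : LowerSet P → F` with `g (↓p) = f p`. -/
theorem stmt15 {P : Type} [PartialOrder P] :
    ∀ (F : Type) [Order.Frame F] (f : P → F), Monotone f →
      sSup (Set.range f) = ⊤ →
      (∀ a b : P, f a ⊓ f b = sSup (f '' {c : P | c ≤ a ∧ c ≤ b})) →
      ∃! g : FrameHom (LowerSet P) F, ∀ p : P, g (LowerSet.Iic p) = f p := by
  intro F _ f hf htop hinf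
  have hmap : ∀ (I : LowerSet P) (x : F), (⨆ p ∈ I, f p) ≤ x ↔ ∀ p ∈ I, f p ≤ x := by
    intro I x
    simp only [iSup_le_iff]
  have hle : ∀ (I : LowerSet P) (p : P), p ∈ I → f p ≤ ⨆ q ∈ I, f q := by
    intro I p hp
    exact (hmap I _).1 le_rfl p hp
  let g : FrameHom (LowerSet P) F :=
    { toFun := fun I => ⨆ p ∈ I, f p
      map_inf' := by
        intro I J
        apply le_antisymm
        · rw [hmap]
          intro p hp
          rw [LowerSet.mem_inf_iff] at hp
          exact le_inf (hle I p hp.1) (hle J p hp.2)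
        · simp only [iSup_inf_eq, inf_iSup_eq, iSup_le_iff]
          intro a ha b hb
          rw [hinf]
          apply sSup_le
          rintro _ ⟨c, ⟨hca, hcb⟩, rfl⟩
          apply hle
          rw [LowerSet.mem_inf_iff]
          exact ⟨I.lower hca hb, J.lower hcb ha⟩
      map_top' := by
        rw [← top_le_iff, ← htop]
        apply sSup_le
        rintro _ ⟨p, rfl⟩
        exact hle ⊤ p (LowerSet.mem_top)
      map_sSup' := by
        intro S
        apply le_antisymm
        · rw [hmap]
          intro p hp
          obtain ⟨I, hI, hpI⟩ := LowerSet.mem_sSup_iff.1 hp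
          exact (hle I p hpI).trans (le_sSup ⟨I, hI, rfl⟩)
        · apply sSup_le
          rintro _ ⟨I, hI, rfl⟩
          refine (hmap I _).2 fun p hp => hle _ p (LowerSet.mem_sSup_iff.2 ⟨I, hI, hp⟩) }
  refine ⟨g, ?_, ?_⟩
  · intro p
    apply le_antisymm
    · refine (hmap _ _).2 fun q hq => hf (LowerSet.mem_Iic_iff.1 hq)
    · exact hle _ p (LowerSet.mem_Iic_iff.2 le_rfl)
  · intro h hh
    ext I
    change h I = ⨆ p ∈ I, f p
    have hI : I = ⨆ p ∈ I, LowerSet.Iic p := by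
      ext q
      simp only [SetLike.mem_coe, LowerSet.mem_iSup_iff, LowerSet.mem_Iic_iff]
      constructor
      · intro hq
        exact ⟨q, hq, le_rfl⟩
      · rintro ⟨p, hp, hqp⟩
        exact I.lower hqp hp
    conv_lhs => rw [hI]
    simp only [map_iSup, hh]
end

section
/- Let P and Q be posets and let f : P → Q be a flat monotone map. Then the map g from the frame of lower sets of P to the frame of lower sets of Q sending a lower set I to the lower closure of the image f(I) (i.e. {q ∈ Q : q ≤ f(p) for some p ∈ I}) is a frame homomorphism, and g sends each principal lower set ↓p to the principal lower set ↓f(p); in particular f is recovered from g as its restriction to principal lower sets. -/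
/-- A monotone map between preorders is flat if every `q` is below some `f p`,
and whenever `q ≤ f p` and `q ≤ f p'` there is `p''` with `p'' ≤ p`,
`p'' ≤ p'` and `q ≤ f p''`. -/
def IsFlatMap {P Q : Type*} [Preorder P] [Preorder Q] (f : P → Q) : Prop :=
  (∀ q : Q, ∃ p : P, q ≤ f p) ∧
    ∀ (q : Q) (p p' : P), q ≤ f p → q ≤ f p' →
      ∃ p'' : P, p'' ≤ p ∧ p'' ≤ p' ∧ q ≤ f p''

/-- The lower closure of the image of a lower set under `f`. -/
def lowerImage {P Q : Type*} [Preorder P] [Preorder Q] (f : P → Q)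
    (I : LowerSet P) : LowerSet Q where
  carrier := {q : Q | ∃ p ∈ I, q ≤ f p}
  lower' := by
    rintro a b hba ⟨p, hp, h⟩
    exact ⟨p, hp, hba.trans h⟩

theorem mem_lowerImage_iff {P Q : Type*} [Preorder P] [Preorder Q] (f : P → Q)
    (I : LowerSet P) (q : Q) : q ∈ lowerImage f I ↔ ∃ p ∈ I, q ≤ f p := Iff.rfl

/-- For a flat monotone map `f : P → Q` of posets, the map
sending a lower set `I` of `P` to the lower closure of `f '' I` is a frame
homomorphism between the frames of lower sets (it preserves arbitrary suprema,
binary meets and the top element), and it sends `↓p` to `↓(f p)`; in particular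
`f` is recovered from it by restriction to principal lower sets. -/
theorem stmt17 {P Q : Type*} [PartialOrder P] [PartialOrder Q] (f : P → Q)
    (hmono : Monotone f) (hflat : IsFlatMap f) :
    (∀ S : Set (LowerSet P), lowerImage f (sSup S) = sSup (lowerImage f '' S)) ∧
      (∀ I J : LowerSet P, lowerImage f (I ⊓ J) = lowerImage f I ⊓ lowerImage f J) ∧
      lowerImage f ⊤ = ⊤ ∧
      ∀ p : P, lowerImage f (LowerSet.Iic p) = LowerSet.Iic (f p) := by
  refine ⟨fun S => ?_, fun I J => ?_, ?_, fun p => ?_⟩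
  · ext q
    simp only [SetLike.mem_coe, mem_lowerImage_iff, LowerSet.mem_sSup_iff]
    constructor
    · rintro ⟨p, ⟨I, hI, hp⟩, hq⟩
      exact ⟨lowerImage f I, ⟨I, hI, rfl⟩, p, hp, hq⟩
    · rintro ⟨_, ⟨I, hI, rfl⟩, p, hp, hq⟩
      exact ⟨p, ⟨I, hI, hp⟩, hq⟩
  · ext q
    simp only [SetLike.mem_coe, mem_lowerImage_iff, LowerSet.mem_inf_iff]
    constructor
    · rintro ⟨p, ⟨hI, hJ⟩, hq⟩
      exact ⟨⟨p, hI, hq⟩, ⟨p, hJ, hq⟩⟩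
    · rintro ⟨⟨p, hp, hq⟩, ⟨p', hp', hq'⟩⟩
      obtain ⟨r, hr, hr', h⟩ := hflat.2 q p p' hq hq'
      exact ⟨r, ⟨I.lower hr hp, J.lower hr' hp'⟩, h⟩
  · ext q
    simp only [SetLike.mem_coe, mem_lowerImage_iff, LowerSet.mem_top, true_and, iff_true]
    exact hflat.1 q
  · ext q
    simp only [SetLike.mem_coe, mem_lowerImage_iff, LowerSet.mem_Iic_iff]
    constructor
    · rintro ⟨r, hr, hq⟩
      exact hq.trans (hmono hr)
    · intro hq
      exact ⟨p, le_rfl, hq⟩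
end
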